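/- Let S ⊂ ℙ(V) be a reduced irreducible ruled surface of degree d ≥ 3 which is not a cone, with C̃ ⊂ Gr(2,V) the set of lines on S and C its irreducible degree-d curve component. If w̄₀ ∈ C̃ \ C (i.e., w̄₀ is an isolated line of S), then C is contained in the projective tangent space T_{Gr, w̄₀} of Gr at w̄₀; equivalently, the line w̄₀ intersects every line of S belonging to C. -/

import Mathlib

namespace RQS

open MvPolynomial


open MvPolynomial

variable (K : Type) [Field K]

/-- Projective n-space modelled as the projectivization of `Fin n → K`
(so `PP K (n+1)` is ℙⁿ). -/
abbrev PP (n : ℕ) : Type := Projectivization K (Fin n → K)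

variable {K}

/-- Vanishing of a (homogeneous) polynomial at a projective point. -/
def vanishes {n : ℕ} (p : MvPolynomial (Fin n) K) (x : PP K n) : Prop :=
  ∀ (v : Fin n → K) (h : v ≠ 0), Projectivization.mk K v h = x → eval v p = 0

/-- Projective zero locus of a set of polynomials. -/
def zeroLocus {n : ℕ} (S : Set (MvPolynomial (Fin n) K)) : Set (PP K n) :=
  {x | ∀ p ∈ S, vanishes p x}

/-- Zariski closed subsets of projective space. -/
def ZClosed {n : ℕ} (X : Set (PP K n)) : Prop :=
  ∃ S : Set (MvPolynomial (Fin n) K), (∀ p ∈ S, ∃ d, p.IsHomogeneous d) ∧ X = zeroLocus S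

/-- Irreducibility with respect to the Zariski topology. -/
def ZIrred {n : ℕ} (X : Set (PP K n)) : Prop :=
  X.Nonempty ∧ ∀ A B : Set (PP K n), ZClosed A → ZClosed B → X ⊆ A ∪ B → X ⊆ A ∨ X ⊆ B

/-- `X` contains a chain of closed irreducible subsets of length `d+1`. -/
def dimGE {n : ℕ} (X : Set (PP K n)) (d : ℕ) : Prop :=
  ∃ f : Fin (d + 1) → Set (PP K n),
    (∀ i, ZClosed (f i) ∧ ZIrred (f i) ∧ f i ⊆ X) ∧ StrictMono f

/-- `X` has (Krull) dimension exactly `d`. -/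
def HasDim {n : ℕ} (X : Set (PP K n)) (d : ℕ) : Prop := dimGE X d ∧ ¬ dimGE X (d + 1)

/-- The hyperplane with coefficient vector `φ`. -/
def hyp {n : ℕ} (φ : Fin n → K) : Set (PP K n) :=
  {x | ∀ (v : Fin n → K) (h : v ≠ 0), Projectivization.mk K v h = x → ∑ i, φ i * v i = 0}

/-- Degree of a (reduced) curve: every hyperplane not containing it meets it in at most `d`
points, and some hyperplane meets it in exactly `d` points. -/
def HasCurveDeg {n : ℕ} (X : Set (PP K n)) (d : ℕ) : Prop :=
  (∀ φ : Fin n → K, φ ≠ 0 → ¬ X ⊆ hyp φ →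
    (X ∩ hyp φ).Finite ∧ (X ∩ hyp φ).ncard ≤ d) ∧
  (∃ φ : Fin n → K, φ ≠ 0 ∧ ¬ X ⊆ hyp φ ∧ (X ∩ hyp φ).ncard = d)

/-- An irreducible projective curve of degree `d`. -/
def IsCurveOfDeg {n : ℕ} (X : Set (PP K n)) (d : ℕ) : Prop :=
  ZClosed X ∧ ZIrred X ∧ HasDim X 1 ∧ HasCurveDeg X d

/-- A property holds at a general point of `S`. -/
def GenericPts {n : ℕ} (S : Set (PP K n)) (Q : PP K n → Prop) : Prop :=
  ∃ T : Set (PP K n), ZClosed T ∧ ¬ S ⊆ T ∧ ∀ p ∈ S, p ∉ T → Q p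

/-! ### Plücker coordinates: `p₁₂,p₁₃,p₁₄,p₂₃,p₂₄,p₃₄` indexed by `0,…,5` -/

/-- Plücker coordinates of the line through `u` and `v`, i.e. the bivector `u ∧ v`. -/
def plucker (u v : Fin 4 → K) : Fin 6 → K :=
  ![u 0 * v 1 - u 1 * v 0, u 0 * v 2 - u 2 * v 0, u 0 * v 3 - u 3 * v 0,
    u 1 * v 2 - u 2 * v 1, u 1 * v 3 - u 3 * v 1, u 2 * v 3 - u 3 * v 2]

/-- The Plücker quadric `p₁₂p₃₄ - p₁₃p₂₄ + p₁₄p₂₃`, i.e. `½ w ∧ w`. -/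
def plQuad (w : Fin 6 → K) : K := w 0 * w 5 - w 1 * w 4 + w 2 * w 3

/-- The wedge pairing `w ∧ z ∈ Λ⁴V ≅ K` of two bivectors. -/
def plPair (w z : Fin 6 → K) : K :=
  w 0 * z 5 + w 5 * z 0 - w 1 * z 4 - w 4 * z 1 + w 2 * z 3 + w 3 * z 2

/-- The wedge `w ∧ v ∈ Λ³V ≅ V*` of a bivector `w` with a vector `v`;
`w ∧ v = 0` expresses that the point `v̄` lies on the line `w̄`. -/
def wedgePt (w : Fin 6 → K) (v : Fin 4 → K) : Fin 4 → K :=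
  ![w 0 * v 2 - w 1 * v 1 + w 3 * v 0,
    w 0 * v 3 - w 2 * v 1 + w 4 * v 0,
    w 1 * v 3 - w 2 * v 2 + w 5 * v 0,
    w 3 * v 3 - w 4 * v 2 + w 5 * v 1]

/-- The set of points of ℙ³ on the line with Plücker vector `w`. -/
def lineOfRep (w : Fin 6 → K) : Set (PP K 4) :=
  {p | ∀ (v : Fin 4 → K) (h : v ≠ 0), Projectivization.mk K v h = p → wedgePt w v = 0}

/-- `w` represents a line of ℙ³: it is nonzero and decomposable. -/
def IsLineRep (w : Fin 6 → K) : Prop := w ≠ 0 ∧ plQuad w = 0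

variable (K) in
/-- The Grassmannian `Gr(2,4) ⊂ ℙ⁵` of lines in ℙ³. -/
def grass : Set (PP K 6) :=
  {x | ∃ (w : Fin 6 → K) (h : w ≠ 0), Projectivization.mk K w h = x ∧ plQuad w = 0}

/-- The line in ℙ³ corresponding to a point `x` of the Grassmannian. -/
def lineOf (x : PP K 6) : Set (PP K 4) :=
  {p | ∀ (w : Fin 6 → K) (h : w ≠ 0), Projectivization.mk K w h = x → p ∈ lineOfRep w}

/-- The set of (Grassmann points of) lines contained in a surface `S ⊂ ℙ³`. -/
def linesOf (S : Set (PP K 4)) : Set (PP K 6) :=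
  {x | x ∈ grass K ∧ lineOf x ⊆ S}

/-- A ruled surface: an irreducible closed surface which is a union of lines. -/
def IsRuled (S : Set (PP K 4)) : Prop :=
  ZClosed S ∧ ZIrred S ∧ HasDim S 2 ∧ ∀ p ∈ S, ∃ x ∈ linesOf S, p ∈ lineOf x

/-- Degree of a surface in ℙ³ via intersections with lines. -/
def HasSurfDeg (S : Set (PP K 4)) (d : ℕ) : Prop :=
  (∀ w : Fin 6 → K, IsLineRep w → ¬ lineOfRep w ⊆ S →
    (S ∩ lineOfRep w).Finite ∧ (S ∩ lineOfRep w).ncard ≤ d) ∧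
  (∃ w : Fin 6 → K, IsLineRep w ∧ ¬ lineOfRep w ⊆ S ∧ (S ∩ lineOfRep w).ncard = d)

/-- A cone: all lines of `S` pass through a common point. -/
def IsCone (S : Set (PP K 4)) : Prop :=
  ∃ p : PP K 4, ∀ x ∈ linesOf S, p ∈ lineOf x

/-- `σ₂(p₀)`: the 2-plane in the Grassmannian of all lines through `p₀`. -/
def sigma2 (p₀ : PP K 4) : Set (PP K 6) := {x | x ∈ grass K ∧ p₀ ∈ lineOf x}

/-- The projective tangent space `T_{Gr,x₀}` of the Plücker quadric at `x₀`,
namely the hyperplane `{z̄ : w₀ ∧ z = 0}`. -/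
def tangentGr (x₀ : PP K 6) : Set (PP K 6) :=
  {x | ∀ (w : Fin 6 → K) (h : w ≠ 0), Projectivization.mk K w h = x →
    ∀ (w₀ : Fin 6 → K) (h₀ : w₀ ≠ 0), Projectivization.mk K w₀ h₀ = x₀ → plPair w₀ w = 0}

/-- The linear span of (the representatives of) a subset of projective space. -/
def spanOfSet {n : ℕ} (X : Set (PP K n)) : Submodule K (Fin n → K) :=
  Submodule.span K {v | ∃ h : v ≠ 0, Projectivization.mk K v h ∈ X}

/-- The projective subspace associated to a linear subspace. -/
def projSub {n : ℕ} (U : Submodule K (Fin n → K)) : Set (PP K n) :=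
  {x | ∀ (v : Fin n → K) (h : v ≠ 0), Projectivization.mk K v h = x → v ∈ U}

/-- `P(C)`: the smallest projective subspace containing `C`. -/
def projSpanOf {n : ℕ} (X : Set (PP K n)) : Set (PP K n) := projSub (spanOfSet X)

/-! ### Smoothness via Jacobian criteria -/

/-- The homogeneous polynomials vanishing on `X`. -/
def homIdeal {n : ℕ} (X : Set (PP K n)) : Set (MvPolynomial (Fin n) K) :=
  {p | (∃ d, p.IsHomogeneous d) ∧ ∀ x ∈ X, vanishes p x}

/-- The span of the gradients at `v` of all homogeneous polynomials vanishing on `X`. -/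
def gradSpan {n : ℕ} (X : Set (PP K n)) (v : Fin n → K) : Submodule K (Fin n → K) :=
  Submodule.span K
    {g | ∃ p ∈ homIdeal X, g = fun i => eval v (pderiv i p)}

/-- Smooth point of a projective *curve* `X ⊂ ℙ(Kⁿ)` (Jacobian criterion:
the affine cone over `X` has a 2-dimensional tangent space there). -/
def CurveSmoothPt {n : ℕ} (X : Set (PP K n)) (x : PP K n) : Prop :=
  ∀ (v : Fin n → K) (h : v ≠ 0), Projectivization.mk K v h = x →
    Module.finrank K (gradSpan X v) = n - 2

/-- Smooth point of a *surface* `S ⊂ ℙ³` (Jacobian criterion). -/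
def SurfSmoothPt (S : Set (PP K 4)) (x : PP K 4) : Prop :=
  ∀ (v : Fin 4 → K) (h : v ≠ 0), Projectivization.mk K v h = x →
    Module.finrank K (gradSpan S v) = 1

/-- The singular locus of a surface `S ⊂ ℙ³`. -/
def singLocus (S : Set (PP K 4)) : Set (PP K 4) := {x ∈ S | ¬ SurfSmoothPt S x}

/-! ### Elimination theory -/

lemma homogeneousComponent_succ_mul {n : ℕ} (N : ℕ) (b L : MvPolynomial (Fin n) K)
    (hL : L.IsHomogeneous 1) :
    homogeneousComponent (N + 1) (b * L) = homogeneousComponent N b * L := by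
  induction b using MvPolynomial.induction_on' with
  | monomial d c =>
    have hd : (monomial d c : MvPolynomial (Fin n) K).IsHomogeneous d.degree :=
      isHomogeneous_monomial c rfl
    rw [homogeneousComponent_of_mem hd, homogeneousComponent_of_mem (hd.mul hL)]
    by_cases h : d.degree = N <;> simp [h]
  | add p q hp hq => simp [add_mul, hp, hq]

lemma homogeneousComponent_mem_span {n : ℕ} {F : Set (MvPolynomial (Fin n) K)}
    (hF : ∀ p ∈ F, ∃ d, p.IsHomogeneous d) {f : MvPolynomial (Fin n) K}
    (hf : f ∈ Ideal.span F) (N : ℕ) : homogeneousComponent N f ∈ Ideal.span F := by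
  let := MvPolynomial.gradedAlgebra (σ := Fin n) (R := K)
  exact homogeneousComponent_mem_of_mem (Ideal.homogeneous_span _ F hF) hf N

lemma eval_eq_zero_of_mem_span {n : ℕ} {F : Set (MvPolynomial (Fin n) K)} {w : Fin n → K}
    (hw : ∀ p ∈ F, eval w p = 0) {f : MvPolynomial (Fin n) K} (hf : f ∈ Ideal.span F) :
    eval w f = 0 := by
  have : Ideal.span F ≤ RingHom.ker (eval w) := Ideal.span_le.2 hw
  exact this hf

/-- If homogeneous polynomials `F` and linear forms `L` have only the trivial common zero, then
in large degree every form is a combination of the `L i` on the zero locus of `F`. -/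
lemma exists_degree_combination [IsAlgClosed K] {n m : ℕ} {F : Set (MvPolynomial (Fin n) K)}
    (hF : ∀ p ∈ F, ∃ d, p.IsHomogeneous d) (L : Fin m → MvPolynomial (Fin n) K)
    (hL : ∀ i, (L i).IsHomogeneous 1)
    (h : ∀ w : Fin n → K, w ≠ 0 → (∀ p ∈ F, eval w p = 0) → ∃ i, eval w (L i) ≠ 0) :
    ∃ N : ℕ, ∀ p : MvPolynomial (Fin n) K, p.IsHomogeneous (N + 1) →
      ∃ b : Fin m → MvPolynomial (Fin n) K, (∀ i, (b i).IsHomogeneous N) ∧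
        ∀ w, (∀ q ∈ F, eval w q = 0) → eval w p = ∑ i, eval w (b i) * eval w (L i) := by
  set J : Ideal (MvPolynomial (Fin n) K) := Ideal.span F ⊔ Ideal.span (Set.range L) with hJ
  have hrad : idealOfVars (Fin n) K ≤ J.radical := by
    rw [← vanishingIdeal_zeroLocus_eq_radical (K := K) J, idealOfVars, Ideal.span_le]
    rintro _ ⟨k, rfl⟩
    rw [SetLike.mem_coe, mem_vanishingIdeal_iff]
    intro w hw
    by_contra hk
    have hw0 : w ≠ 0 := by
      rintro rfl
      simp at hk
    obtain ⟨i, hi⟩ := h w hw0 fun p hp => by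
      simpa [aeval_eq_eval] using hw p (hJ ▸ Ideal.mem_sup_left (Ideal.subset_span hp))
    have hLi := hw (L i) (hJ ▸ Ideal.mem_sup_right (Ideal.subset_span ⟨i, rfl⟩))
    exact hi (by simpa [aeval_eq_eval] using hLi)
  obtain ⟨N, hN⟩ := Ideal.exists_pow_le_of_le_radical_of_fg hrad (idealOfVars_fg _ _)
  refine ⟨N, fun p hp => ?_⟩
  have hpJ : p ∈ J := by
    refine hN ((mem_pow_idealOfVars_iff' N p).2 fun x hx => hp.coeff_eq_zero ?_)
    omega
  obtain ⟨f, hf, g, hg, rfl⟩ := Submodule.mem_sup.1 hpJ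
  obtain ⟨b, rfl⟩ := (Ideal.mem_span_range_iff_exists_fun).1 hg
  refine ⟨fun i => homogeneousComponent N (b i), fun i => homogeneousComponent_isHomogeneous _ _,
    fun w hw => ?_⟩
  rw [← homogeneousComponent_eq_self hp]
  simp only [map_add, map_sum, homogeneousComponent_succ_mul _ _ _ (hL _), map_mul]
  rw [eval_eq_zero_of_mem_span hw (homogeneousComponent_mem_span hF hf _), zero_add]

lemma isHomogeneous_det {n k : ℕ} (M : Matrix (Fin k) (Fin k) (MvPolynomial (Fin n) K))
    (hM : ∀ a c, (M a c).IsHomogeneous 1) : M.det.IsHomogeneous k := by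
  rw [Matrix.det_apply]
  refine IsHomogeneous.sum _ _ _ fun σ _ => ?_
  have h : (∏ a, M (σ a) a).IsHomogeneous k := by
    simpa using IsHomogeneous.prod Finset.univ (fun a => M (σ a) a) (fun _ => 1)
      fun a _ => hM (σ a) a
  rcases Int.units_eq_one_or (Equiv.Perm.sign σ) with hσ | hσ
  · simpa [hσ] using h
  · simpa [hσ] using h.neg

/-- A point `v₀` outside the projection of a projective incidence variety given by homogeneous
polynomials `F` in `w` and forms linear in `v` and in `w` is separated from that projection by a
homogeneous polynomial. -/
lemma exists_eliminant [IsAlgClosed K] {n m k : ℕ} {F : Set (MvPolynomial (Fin n) K)}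
    (hF : ∀ p ∈ F, ∃ d, p.IsHomogeneous d) (ℓ : Fin m → Fin k → MvPolynomial (Fin n) K)
    (hℓ : ∀ i j, (ℓ i j).IsHomogeneous 1) (v₀ : Fin k → K)
    (h : ∀ w : Fin n → K, w ≠ 0 → (∀ p ∈ F, eval w p = 0) →
      ∃ i, ∑ j, v₀ j * eval w (ℓ i j) ≠ 0) :
    ∃ (G : MvPolynomial (Fin k) K) (e : ℕ), G.IsHomogeneous e ∧ eval v₀ G ≠ 0 ∧
      ∀ w : Fin n → K, w ≠ 0 → (∀ p ∈ F, eval w p = 0) →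
        ∀ v : Fin k → K, (∀ i, ∑ j, v j * eval w (ℓ i j) = 0) → eval v G = 0 := by
  obtain ⟨N, hN⟩ := exists_degree_combination hF (fun i => ∑ j, C (v₀ j) * ℓ i j)
    (fun i => IsHomogeneous.sum _ _ _ fun j _ => (hℓ i j).C_mul _)
    (fun w hw hwF => by simpa using h w hw hwF)
  let A : Set (Fin n → K) := {w | ∀ p ∈ F, eval w p = 0}
  let res : MvPolynomial (Fin n) K →ₗ[K] (A → K) :=
    LinearMap.pi fun w => (aeval (w : Fin n → K)).toLinearMap
  have res_apply (p : MvPolynomial (Fin n) K) (w : A) : res p w = eval (w : Fin n → K) p := by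
    simp [res, aeval_eq_eval]
  let U : Submodule K (A → K) := (homogeneousSubmodule (Fin n) K (N + 1)).map res
  have : Module.Finite K U :=
    Module.Finite.iff_fg.2 ((homogeneousSubmodule_fg (Fin n) K (N + 1)).map res)
  let e := Module.finBasis K U
  have hrep (a) : ∃ p : MvPolynomial (Fin n) K, p.IsHomogeneous (N + 1) ∧
      res p = (e a : A → K) := by
    obtain ⟨p, hp, hpe⟩ := (e a).2
    exact ⟨p, hp, hpe⟩
  choose p hp hpe using hrep
  choose b hb hbp using fun a => hN (p a) (hp a)
  let Q (a) (j : Fin k) : MvPolynomial (Fin n) K := ∑ i, b a i * ℓ i j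
  have hQ (a j) : (Q a j).IsHomogeneous (N + 1) :=
    IsHomogeneous.sum _ _ _ fun i _ => (hb a i).mul (hℓ i j)
  let q (a) (j : Fin k) : U := ⟨res (Q a j), Q a j, hQ a j, rfl⟩
  have hqe (a) : ∑ j, v₀ j • q a j = e a := by
    ext w
    have hw := hbp a w w.2
    rw [← res_apply, hpe] at hw
    rw [hw]
    simp only [q, Q, Submodule.coe_sum, Submodule.coe_smul, Finset.sum_apply, Pi.smul_apply,
      res_apply, map_sum, map_mul, smul_eq_mul, Finset.mul_sum, eval_C]
    rw [Finset.sum_comm]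
    exact Finset.sum_congr rfl fun i _ => Finset.sum_congr rfl fun j _ => by ring
  let M : Matrix (Fin (Module.finrank K U)) (Fin (Module.finrank K U)) (MvPolynomial (Fin k) K) :=
    Matrix.of fun a c => ∑ j, C (e.repr (q a j) c) * X j
  have hMdet (v : Fin k → K) :
      eval v M.det = (Matrix.of fun a c => ∑ j, e.repr (q a j) c * v j).det := by
    rw [RingHom.map_det]
    congr 1
    ext a c
    simp [M]
  have hM (a c) : (M a c).IsHomogeneous 1 := by
    simp only [M, Matrix.of_apply]
    exact IsHomogeneous.sum _ _ _ fun j _ => isHomogeneous_C_mul_X _ _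
  refine ⟨M.det, _, isHomogeneous_det M hM, ?_, fun w hw hwF v hv => ?_⟩
  · have hone : (Matrix.of fun a c => ∑ j, e.repr (q a j) c * v₀ j) = 1 := by
      ext a c
      have hc := congrArg (fun u => e.repr u c) (hqe a)
      simp only [map_sum, map_smul, Finsupp.finsetSum_apply, Finsupp.smul_apply, smul_eq_mul,
        Module.Basis.repr_self] at hc
      rw [Matrix.of_apply, Matrix.one_apply, ← Finsupp.single_apply, ← hc]
      exact Finset.sum_congr rfl fun j _ => mul_comm _ _
    rw [hMdet, hone, Matrix.det_one]
    exact one_ne_zero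
  · rw [hMdet, ← Matrix.exists_mulVec_eq_zero_iff]
    have hexp (u : U) : (u : A → K) ⟨w, hwF⟩ =
        ∑ c, e.repr u c * (e c : A → K) ⟨w, hwF⟩ := by
      have hu := congrFun (congrArg Subtype.val (e.sum_repr u)) ⟨w, hwF⟩
      rw [← hu]
      simp only [Submodule.coe_sum, Submodule.coe_smul, Finset.sum_apply, Pi.smul_apply,
        smul_eq_mul]
    refine ⟨fun c => (e c : A → K) ⟨w, hwF⟩, fun hzero => hw ?_, ?_⟩
    · ext i
      have hXi := hexp ⟨res (X i ^ (N + 1)), _, isHomogeneous_X_pow i (N + 1), rfl⟩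
      have hz (c) : (e c : A → K) ⟨w, hwF⟩ = 0 := congrFun hzero c
      simp only [hz, mul_zero, Finset.sum_const_zero, res_apply, map_pow, eval_X] at hXi
      exact pow_eq_zero_iff (Nat.succ_ne_zero N) |>.1 hXi
    · ext a
      calc _ = ∑ j, v j * ((q a j : A → K) ⟨w, hwF⟩) := by
            simp only [hexp (q a _), Matrix.mulVec, dotProduct, Matrix.of_apply,
              Finset.sum_mul, Finset.mul_sum]
            rw [Finset.sum_comm]
            exact Finset.sum_congr rfl fun j _ => Finset.sum_congr rfl fun c _ => by ring
        _ = ∑ i, eval w (b a i) * ∑ j, v j * eval w (ℓ i j) := by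
            simp only [q, Q, res_apply, map_sum, map_mul, Finset.mul_sum]
            rw [Finset.sum_comm]
            exact Finset.sum_congr rfl fun i _ => Finset.sum_congr rfl fun j _ => by ring
        _ = 0 := by simp [hv]

/-! ### Zariski closed sets -/

lemma eval_smul_of_isHomogeneous {n d : ℕ} {p : MvPolynomial (Fin n) K} (hp : p.IsHomogeneous d)
    (a : K) (v : Fin n → K) : eval (a • v) p = a ^ d * eval v p := by
  rw [eval_eq, eval_eq, Finset.mul_sum]
  refine Finset.sum_congr rfl fun m hm => ?_
  have hdeg : ∑ i ∈ m.support, m i = d := hp.degree_eq_sum_deg_support hm |>.symm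
  simp only [Pi.smul_apply, smul_eq_mul, mul_pow, Finset.prod_mul_distrib,
    Finset.prod_pow_eq_pow_sum, hdeg]
  ring

lemma vanishes_mk {n d : ℕ} {p : MvPolynomial (Fin n) K} (hp : p.IsHomogeneous d)
    {v : Fin n → K} (hv : v ≠ 0) : vanishes p (Projectivization.mk K v hv) ↔ eval v p = 0 := by
  refine ⟨fun h => h v hv rfl, fun h u hu huv => ?_⟩
  obtain ⟨a, rfl⟩ := (Projectivization.mk_eq_mk_iff' K _ _ hu hv).1 huv
  rw [eval_smul_of_isHomogeneous hp, h, mul_zero]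

lemma ZClosed.union {n : ℕ} {X Y : Set (PP K n)} (hX : ZClosed X) (hY : ZClosed Y) :
    ZClosed (X ∪ Y) := by
  obtain ⟨F, hF, rfl⟩ := hX
  obtain ⟨G, hG, rfl⟩ := hY
  refine ⟨{r | ∃ p ∈ F, ∃ q ∈ G, r = p * q}, ?_, ?_⟩
  · rintro _ ⟨p, hp, q, hq, rfl⟩
    obtain ⟨a, ha⟩ := hF p hp
    obtain ⟨b, hb⟩ := hG q hq
    exact ⟨a + b, ha.mul hb⟩
  · ext x
    induction x using Projectivization.ind with | _ v hv
    constructor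
    · rintro (h | h) _ ⟨p, hp, q, hq, rfl⟩ u hu huv
      · rw [map_mul, h p hp u hu huv, zero_mul]
      · rw [map_mul, h q hq u hu huv, mul_zero]
    · intro h
      by_contra hnot
      simp only [Set.mem_union, not_or, zeroLocus, Set.mem_ofPred_eq, not_forall] at hnot
      obtain ⟨⟨p, hp, hpv⟩, q, hq, hqv⟩ := hnot
      obtain ⟨a, ha⟩ := hF p hp
      obtain ⟨b, hb⟩ := hG q hq
      rw [vanishes_mk ha hv] at hpv
      rw [vanishes_mk hb hv] at hqv
      have hpq := h (p * q) ⟨p, hp, q, hq, rfl⟩ v hv rfl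
      rw [map_mul] at hpq
      exact (mul_ne_zero hpv hqv) hpq

lemma ZClosed.empty {n : ℕ} : ZClosed (∅ : Set (PP K n)) := by
  refine ⟨{1}, fun p hp => ⟨0, hp ▸ isHomogeneous_one _ _⟩, ?_⟩
  ext x
  induction x using Projectivization.ind with | _ v hv
  simp only [Set.mem_empty_iff_false, false_iff]
  intro h
  simpa using h 1 rfl v hv rfl

lemma ZClosed.biUnion {n : ℕ} {ι : Type*} {T : Set ι} (hT : T.Finite) (X : ι → Set (PP K n))
    (hX : ∀ i, ZClosed (X i)) : ZClosed (⋃ i ∈ T, X i) := by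
  induction T, hT using Set.Finite.induction_on with
  | empty => simpa using ZClosed.empty
  | insert _ _ ih =>
    rw [Set.biUnion_insert]
    exact (hX _).union ih

/-- An irreducible set covered by finitely many closed sets lies in one of them. -/
lemma ZIrred.subset_of_subset_biUnion {n : ℕ} {S : Set (PP K n)} (hS : ZIrred S) {ι : Type*}
    {T : Set ι} (hT : T.Finite) (X : ι → Set (PP K n)) (hX : ∀ i, ZClosed (X i))
    (h : S ⊆ ⋃ i ∈ T, X i) : ∃ i ∈ T, S ⊆ X i := by
  induction T, hT using Set.Finite.induction_on with
  | empty =>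
    obtain ⟨x, hx⟩ := hS.1
    simpa using h hx
  | @insert a T _ hT ih =>
    rw [Set.biUnion_insert] at h
    rcases hS.2 _ _ (hX a) (ZClosed.biUnion hT X hX) h with h | h
    · exact ⟨a, Set.mem_insert _ _, h⟩
    · obtain ⟨i, hi, hSi⟩ := ih h
      exact ⟨i, Set.mem_insert_of_mem _ hi, hSi⟩

/-! ### Lines in projective space -/

lemma wedgePt_smul_left (a : K) (w : Fin 6 → K) (v : Fin 4 → K) :
    wedgePt (a • w) v = a • wedgePt w v := by
  ext i
  fin_cases i <;> simp [wedgePt] <;> ring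

lemma wedgePt_smul_right (a : K) (w : Fin 6 → K) (v : Fin 4 → K) :
    wedgePt w (a • v) = a • wedgePt w v := by
  ext i
  fin_cases i <;> simp [wedgePt] <;> ring

lemma wedgePt_plucker (u v : Fin 4 → K) (s t : K) :
    wedgePt (plucker u v) (s • u + t • v) = 0 := by
  ext i
  fin_cases i <;> simp [wedgePt, plucker] <;> ring

lemma plQuad_smul (a : K) (w : Fin 6 → K) : plQuad (a • w) = a ^ 2 * plQuad w := by
  simp [plQuad]
  ring

lemma mk_mem_lineOf {w : Fin 6 → K} (hw : w ≠ 0) {v : Fin 4 → K} (hv : v ≠ 0) :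
    Projectivization.mk K v hv ∈ lineOf (Projectivization.mk K w hw) ↔ wedgePt w v = 0 := by
  refine ⟨fun h => h w hw rfl v hv rfl, fun h w' hw' hww v' hv' hvv => ?_⟩
  obtain ⟨a, rfl⟩ := (Projectivization.mk_eq_mk_iff' K _ _ hw' hw).1 hww
  obtain ⟨b, rfl⟩ := (Projectivization.mk_eq_mk_iff' K _ _ hv' hv).1 hvv
  rw [wedgePt_smul_left, wedgePt_smul_right, h, smul_zero, smul_zero]

lemma mk_mem_grass {w : Fin 6 → K} (hw : w ≠ 0) :
    Projectivization.mk K w hw ∈ grass K ↔ plQuad w = 0 := by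
  refine ⟨?_, fun h => ⟨w, hw, rfl, h⟩⟩
  rintro ⟨w', hw', hww, h⟩
  obtain ⟨a, rfl⟩ := (Projectivization.mk_eq_mk_iff' K _ _ hw hw').1 hww.symm
  rw [plQuad_smul, h, mul_zero]

/-- A nonzero point of the Plücker quadric is decomposable. -/
lemma exists_eq_plucker {w : Fin 6 → K} (hw : w ≠ 0) (hq : plQuad w = 0) :
    ∃ u v : Fin 4 → K, w = plucker u v := by
  obtain ⟨i, hi⟩ := Function.ne_iff.1 hw
  unfold plQuad at hq
  let r : Fin 4 → Fin 4 → K := ![![0, w 0, w 1, w 2], ![-w 0, 0, w 3, w 4],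
    ![-w 1, -w 3, 0, w 5], ![-w 2, -w 4, -w 5, 0]]
  let e : Fin 6 → Fin 4 × Fin 4 := ![(0, 1), (0, 2), (0, 3), (1, 2), (1, 3), (2, 3)]
  refine ⟨(w i)⁻¹ • r (e i).1, r (e i).2, ?_⟩
  have key : w i • w = plucker (r (e i).1) (r (e i).2) := by
    ext j
    fin_cases i <;> fin_cases j <;> simp [plucker, r, e] <;> grind
  have hsmul (c : K) (u v : Fin 4 → K) : plucker (c • u) v = c • plucker u v := by
    ext j
    fin_cases j <;> simp [plucker] <;> ring
  rw [hsmul, ← key, smul_smul, inv_mul_cancel₀ hi, one_smul]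

lemma coeffs_eq_zero_of_combination_eq_zero {u v : Fin 4 → K} (h : plucker u v ≠ 0) {s t : K}
    (hst : s • u + t • v = 0) : s = 0 ∧ t = 0 := by
  have hi (i : Fin 4) : s * u i + t * v i = 0 := by simpa using congrFun hst i
  have h0 := hi 0
  have h1 := hi 1
  have h2 := hi 2
  have h3 := hi 3
  constructor <;> by_contra hne <;> refine h (funext fun j => ?_) <;>
    refine mul_left_cancel₀ hne ?_ <;> fin_cases j <;> simp [plucker] <;> grind

set_option maxHeartbeats 1600000 in
/-- A line through two points is proportional to the bivector they span. -/
lemma mul_plucker_comm {w : Fin 6 → K} {x y : Fin 4 → K} (hx : wedgePt w x = 0)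
    (hy : wedgePt w y = 0) (i j : Fin 6) : w i * plucker x y j = w j * plucker x y i := by
  have h0 := congrFun hx 0
  have h1 := congrFun hx 1
  have h2 := congrFun hx 2
  have h3 := congrFun hx 3
  have k0 := congrFun hy 0
  have k1 := congrFun hy 1
  have k2 := congrFun hy 2
  have k3 := congrFun hy 3
  simp [wedgePt] at h0 h1 h2 h3 k0 k1 k2 k3
  fin_cases i <;> fin_cases j <;> simp [plucker] <;> grind

lemma mk_eq_mk_plucker {w : Fin 6 → K} (hw : w ≠ 0) {x y : Fin 4 → K} (hxy : plucker x y ≠ 0)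
    (hx : wedgePt w x = 0) (hy : wedgePt w y = 0) :
    Projectivization.mk K w hw = Projectivization.mk K (plucker x y) hxy := by
  obtain ⟨i, hi⟩ := Function.ne_iff.1 hxy
  refine (Projectivization.mk_eq_mk_iff' K _ _ hw hxy).2 ⟨w i * (plucker x y i)⁻¹, ?_⟩
  ext j
  have hij := mul_plucker_comm hx hy i j
  have hi' : plucker x y i ≠ 0 := hi
  simp only [Pi.smul_apply, smul_eq_mul]
  field_simp
  linear_combination hij

/-- Two lines with a common point have zero wedge pairing. -/
lemma plPair_eq_zero_of_wedgePt {w w' : Fin 6 → K} {x : Fin 4 → K} (hx0 : x ≠ 0)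
    (hx : wedgePt w x = 0) (hx' : wedgePt w' x = 0) : plPair w w' = 0 := by
  obtain ⟨i, hi⟩ := Function.ne_iff.1 hx0
  have h0 := congrFun hx 0
  have h1 := congrFun hx 1
  have h2 := congrFun hx 2
  have h3 := congrFun hx 3
  have k0 := congrFun hx' 0
  have k1 := congrFun hx' 1
  have k2 := congrFun hx' 2
  have k3 := congrFun hx' 3
  simp [wedgePt] at h0 h1 h2 h3 k0 k1 k2 k3
  refine mul_left_cancel₀ hi ?_
  fin_cases i <;> simp [plPair] <;> grind

lemma det_eq_plPair (u v a b : Fin 4 → K) :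
    (Matrix.of ![u, v, a, b]).det = plPair (plucker u v) (plucker a b) := by
  simp [Matrix.det_succ_row_zero, Fin.sum_univ_succ, plPair, plucker, Fin.succAbove]
  ring

/-- Two lines with zero wedge pairing have a common point. -/
lemma exists_common_point {w w' : Fin 6 → K} (hw : w ≠ 0) (hw' : w' ≠ 0) (hq : plQuad w = 0)
    (hq' : plQuad w' = 0) (h : plPair w w' = 0) :
    ∃ x : Fin 4 → K, x ≠ 0 ∧ wedgePt w x = 0 ∧ wedgePt w' x = 0 := by
  obtain ⟨u, v, rfl⟩ := exists_eq_plucker hw hq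
  obtain ⟨a, b, rfl⟩ := exists_eq_plucker hw' hq'
  rw [← det_eq_plPair, ← Matrix.exists_vecMul_eq_zero_iff] at h
  obtain ⟨c, hc, hsum⟩ := h
  have hrel : c 0 • u + c 1 • v = -(c 2) • a + -(c 3) • b := by
    ext j
    have hj := congrFun hsum j
    simp [Matrix.vecMul, dotProduct, Fin.sum_univ_succ] at hj ⊢
    linear_combination hj
  refine ⟨c 0 • u + c 1 • v, fun hzero => hc ?_, wedgePt_plucker _ _ _ _, ?_⟩
  · obtain ⟨h0, h1⟩ := coeffs_eq_zero_of_combination_eq_zero hw hzero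
    obtain ⟨h2, h3⟩ := coeffs_eq_zero_of_combination_eq_zero hw' (hrel.symm.trans hzero)
    ext j
    fin_cases j
    · exact h0
    · exact h1
    · exact neg_eq_zero.1 h2
    · exact neg_eq_zero.1 h3
  · rw [hrel]
    exact wedgePt_plucker _ _ _ _

lemma eq_of_lineOf_subset {x y : PP K 6} (hx : x ∈ grass K) (h : lineOf x ⊆ lineOf y) :
    x = y := by
  obtain ⟨w, hw, rfl, hq⟩ := hx
  induction y using Projectivization.ind with | _ z hz
  obtain ⟨u, v, rfl⟩ := exists_eq_plucker hw hq
  have hu : u ≠ 0 := fun h0 => one_ne_zero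
    (coeffs_eq_zero_of_combination_eq_zero hw (s := 1) (t := 0) (by simp [h0])).1
  have hv : v ≠ 0 := fun h0 => one_ne_zero
    (coeffs_eq_zero_of_combination_eq_zero hw (s := 0) (t := 1) (by simp [h0])).2
  have hzu := h ((mk_mem_lineOf hw hu).2 (by simpa using wedgePt_plucker u v 1 0))
  have hzv := h ((mk_mem_lineOf hw hv).2 (by simpa using wedgePt_plucker u v 0 1))
  exact (mk_eq_mk_plucker hz hw ((mk_mem_lineOf hz hu).1 hzu) ((mk_mem_lineOf hz hv).1 hzv)).symm

/-- The coefficient of `v j` in the `i`-th coordinate of `w ∧ v`, as a linear form in `w`. -/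
noncomputable def wedgeCoeff : Fin 4 → Fin 4 → MvPolynomial (Fin 6) K :=
  ![![X 3, -X 1, X 0, 0], ![X 4, -X 2, 0, X 0], ![X 5, 0, -X 2, X 1], ![0, X 5, -X 4, X 3]]

lemma wedgeCoeff_isHomogeneous (i j : Fin 4) :
    (wedgeCoeff i j : MvPolynomial (Fin 6) K).IsHomogeneous 1 := by
  fin_cases i <;> fin_cases j <;> simp only [wedgeCoeff] <;>
    first
    | exact isHomogeneous_X _ _
    | exact (isHomogeneous_X _ _).neg
    | exact isHomogeneous_zero _ _ _

lemma sum_wedgeCoeff (w : Fin 6 → K) (v : Fin 4 → K) (i : Fin 4) :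
    ∑ j, v j * eval w (wedgeCoeff i j) = wedgePt w v i := by
  fin_cases i <;> simp [wedgeCoeff, wedgePt, Fin.sum_univ_succ] <;> ring

lemma lineOf_zClosed (x : PP K 6) : ZClosed (lineOf x) := by
  induction x using Projectivization.ind with | _ w hw
  have hhom (i : Fin 4) : (∑ j, C (eval w (wedgeCoeff i j)) * X j :
      MvPolynomial (Fin 4) K).IsHomogeneous 1 :=
    IsHomogeneous.sum _ _ _ fun j _ => isHomogeneous_C_mul_X _ _
  refine ⟨Set.range fun i => ∑ j, C (eval w (wedgeCoeff i j)) * X j, ?_, ?_⟩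
  · rintro _ ⟨i, rfl⟩
    exact ⟨1, hhom i⟩
  · ext p
    induction p using Projectivization.ind with | _ v hv
    rw [mk_mem_lineOf hw hv, funext_iff]
    simp only [zeroLocus, Set.mem_ofPred_eq, Set.forall_mem_range, vanishes_mk (hhom _) hv]
    refine forall_congr' fun i => ?_
    rw [← sum_wedgeCoeff]
    simp [mul_comm]

/-! ### The surface swept out by a curve of lines -/

/-- If a closed family `C` contains all but finitely many lines of a ruled surface `S`, then every
point of `S` lies on a line of `C`. -/
lemma exists_line_through [IsAlgClosed K] {S : Set (PP K 4)} (hS : IsRuled S) {C : Set (PP K 6)}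
    (hCsub : C ⊆ linesOf S) (hCcl : ZClosed C) (hCne : C.Nonempty)
    (hfin : (linesOf S \ C).Finite) {p : PP K 4} (hp : p ∈ S) : ∃ x ∈ C, p ∈ lineOf x := by
  by_contra! hnot
  induction p using Projectivization.ind with | _ v₀ hv₀
  obtain ⟨F, hF, rfl⟩ := hCcl
  have hmem {w : Fin 6 → K} (hw : w ≠ 0) :
      Projectivization.mk K w hw ∈ zeroLocus F ↔ ∀ q ∈ F, eval w q = 0 := by
    refine forall₂_congr fun q hq => ?_
    obtain ⟨d, hd⟩ := hF q hq
    exact vanishes_mk hd hw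
  obtain ⟨G, e, hG, hGv₀, hGzero⟩ := exists_eliminant hF wedgeCoeff wedgeCoeff_isHomogeneous v₀
    fun w hw hwF => by
      have hwv := hnot _ ((hmem hw).2 hwF)
      rw [mk_mem_lineOf hw hv₀] at hwv
      obtain ⟨i, hi⟩ := Function.ne_iff.1 hwv
      exact ⟨i, by rwa [sum_wedgeCoeff]⟩
  have hcover : S ⊆ zeroLocus {G} ∪ ⋃ x ∈ linesOf S \ zeroLocus F, lineOf x := by
    intro q hq
    obtain ⟨x, hx, hqx⟩ := hS.2.2.2 q hq
    by_cases hxC : x ∈ zeroLocus F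
    · left
      induction q using Projectivization.ind with | _ v hv
      induction x using Projectivization.ind with | _ w hw
      rintro _ rfl
      rw [vanishes_mk hG hv]
      refine hGzero w hw ((hmem hw).1 hxC) v fun i => ?_
      rw [sum_wedgeCoeff, (mk_mem_lineOf hw hv).1 hqx, Pi.zero_apply]
    · exact Or.inr (Set.mem_biUnion ⟨hx, hxC⟩ hqx)
  have hGcl : ZClosed (zeroLocus {G}) := ⟨{G}, by rintro _ rfl; exact ⟨e, hG⟩, rfl⟩
  rcases hS.2.1.2 _ _ hGcl (ZClosed.biUnion hfin lineOf lineOf_zClosed) hcover with h | h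
  · exact hGv₀ ((vanishes_mk hG hv₀).1 (h hp G rfl))
  · obtain ⟨y, hy, hSy⟩ := hS.2.1.subset_of_subset_biUnion hfin lineOf lineOf_zClosed h
    obtain ⟨x, hx⟩ := hCne
    exact hy.2 (eq_of_lineOf_subset (hCsub hx).1 ((hCsub hx).2.trans hSy) ▸ hx)

/-- The hyperplane cutting out the tangent space of the Grassmannian at `w`. -/
def polar (w : Fin 6 → K) : Fin 6 → K := ![w 5, -w 4, w 3, w 2, -w 1, w 0]

lemma sum_polar_mul (w z : Fin 6 → K) : ∑ i, polar w i * z i = plPair w z := by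
  simp [polar, plPair, Fin.sum_univ_succ]
  ring

lemma polar_ne_zero {w : Fin 6 → K} (hw : w ≠ 0) : polar w ≠ 0 := by
  refine fun h => hw (funext fun i => ?_)
  have h0 := congrFun h 0
  have h1 := congrFun h 1
  have h2 := congrFun h 2
  have h3 := congrFun h 3
  have h4 := congrFun h 4
  have h5 := congrFun h 5
  simp [polar] at h0 h1 h2 h3 h4 h5
  fin_cases i <;> simp [*]

lemma plPair_smul_left (a : K) (w z : Fin 6 → K) : plPair (a • w) z = a * plPair w z := by
  simp [plPair]
  ring

lemma hyp_polar_subset_tangentGr {w : Fin 6 → K} (hw : w ≠ 0) :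
    hyp (polar w) ⊆ tangentGr (Projectivization.mk K w hw) := by
  intro x hx z hz hzx w' hw' hww
  obtain ⟨a, rfl⟩ := (Projectivization.mk_eq_mk_iff' K _ _ hw' hw).1 hww
  rw [plPair_smul_left, ← sum_polar_mul, hx z hz hzx, mul_zero]

/-- If every point of a line `w₀` outside `C` lies on a line of `C`, then the lines
of `C` meeting `w₀` form an infinite set. -/
lemma infinite_inter_hyp_polar [Infinite K] {C : Set (PP K 6)} {w₀ : Fin 6 → K} (hw₀ : w₀ ≠ 0)
    (hq₀ : plQuad w₀ = 0) (hx₀ : Projectivization.mk K w₀ hw₀ ∉ C)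
    (hC : ∀ p ∈ lineOf (Projectivization.mk K w₀ hw₀), ∃ x ∈ C, p ∈ lineOf x) :
    (C ∩ hyp (polar w₀)).Infinite := by
  obtain ⟨u, v, rfl⟩ := exists_eq_plucker hw₀ hq₀
  have hne (t : K) : u + t • v ≠ 0 := fun h =>
    one_ne_zero (coeffs_eq_zero_of_combination_eq_zero hw₀ (s := 1) (t := t) (by simpa using h)).1
  have hline (t : K) : wedgePt (plucker u v) (u + t • v) = 0 := by
    simpa using wedgePt_plucker u v 1 t
  choose f hfC hf using fun t => hC _ ((mk_mem_lineOf hw₀ (hne t)).2 (hline t))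
  refine Set.infinite_of_injective_forall_mem (f := f) (fun s t hst => ?_) fun t => ⟨hfC t, ?_⟩
  · by_contra hne_st
    have hpl : plucker (u + s • v) (u + t • v) = (t - s) • plucker u v := by
      ext j
      fin_cases j <;> simp [plucker] <;> ring
    have hpl0 : plucker (u + s • v) (u + t • v) ≠ 0 := by
      rw [hpl]
      exact smul_ne_zero (sub_ne_zero.2 (Ne.symm hne_st)) hw₀
    have hs := hf s
    have ht := hf t
    have hCt := hfC t
    rw [hst] at hs
    generalize f t = y at hs ht hCt
    induction y using Projectivization.ind with | _ z hz
    have h1 := mk_eq_mk_plucker hz hpl0 ((mk_mem_lineOf hz _).1 hs) ((mk_mem_lineOf hz _).1 ht)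
    have h2 := mk_eq_mk_plucker hw₀ hpl0 (hline s) (hline t)
    exact hx₀ (h2.trans h1.symm ▸ hCt)
  · intro z hz hzx
    have hft := hf t
    rw [← hzx, mk_mem_lineOf hz (hne t)] at hft
    rw [sum_polar_mul]
    exact plPair_eq_zero_of_wedgePt (hne t) (hline t) hft

/-! STATEMENT 3: an isolated line of a ruled surface meets every line of `C`;
equivalently `C` lies in the tangent space of the Grassmannian at the isolated line. -/

theorem statement_3 (K : Type) [Field K] [IsAlgClosed K]
    (S : Set (PP K 4)) (d : ℕ) (hd : 3 ≤ d)
    (hruled : IsRuled S) (hdeg : HasSurfDeg S d) (hcone : ¬ IsCone S)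
    -- `C` is the irreducible degree-`d` curve component of the set `C̃ = linesOf S`
    -- of lines on `S`, the complement being a finite set:
    (C : Set (PP K 6)) (hCsub : C ⊆ linesOf S)
    (hCcl : ZClosed C) (hCirr : ZIrred C) (hCdim : HasDim C 1) (hCdeg : HasCurveDeg C d)
    (hfin : (linesOf S \ C).Finite)
    -- `w̄₀` is an isolated line of `S`:
    (x₀ : PP K 6) (hx₀ : x₀ ∈ linesOf S \ C) :
    C ⊆ tangentGr x₀ ∧
    ∀ x ∈ C, (lineOf x₀ ∩ lineOf x).Nonempty := by
  obtain ⟨⟨hx₀gr, hx₀S⟩, hx₀C⟩ := hx₀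
  obtain ⟨w₀, hw₀, rfl, hq₀⟩ := hx₀gr
  have : Infinite K := IsAlgClosed.instInfinite
  have hinf : (C ∩ hyp (polar w₀)).Infinite :=
    infinite_inter_hyp_polar hw₀ hq₀ hx₀C fun p hp =>
      exists_line_through hruled hCsub hCcl hCirr.1 hfin (hx₀S hp)
  have hCtan : C ⊆ tangentGr (Projectivization.mk K w₀ hw₀) := by
    by_contra h
    exact hinf (hCdeg.1 _ (polar_ne_zero hw₀)
      fun hsub => h (hsub.trans (hyp_polar_subset_tangentGr hw₀))).1
  refine ⟨hCtan, fun x hx => ?_⟩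
  obtain ⟨w, hw, rfl, hq⟩ := (hCsub hx).1
  obtain ⟨v, hv, h₀, h₁⟩ :=
    exists_common_point hw₀ hw hq₀ hq (hCtan hx w hw rfl w₀ hw₀ rfl)
  exact ⟨Projectivization.mk K v hv, (mk_mem_lineOf hw₀ hv).2 h₀, (mk_mem_lineOf hw hv).2 h₁⟩

end RQS
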